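/- Let A ≥ 1 be a constant such that |⟨V_{ν,i}, ∇_{(x,u)}Φ⟩| ≤ A(δ₁ + |x_{2n} − y_{2n} − g(x̲−y̲)|) for all parameters in the admissible ranges below, and let C₁ ≥ 2A. If ξ = (ξ̄, ξ_{2n+1}) ∈ ℝ^{2n}×ℝ satisfies |ξ_i − ξ_{2n+1}⟨JΓ(y̲^ν), e_i⟩| ≥ C₁δ₁ for some i ∈ {1,…,2n}, then for all y̲ ∈ Q_ν, |y_{2n}| ≤ 1, v ∈ ℝ, (x,u) with |x| + |u − u°| ≤ 2^{−l}, 2^{−l−2} ≤ |σ| ≤ 2^{−l+2}, 1/4 ≤ |τ| ≤ 4: |⟨V_{ν,i}, ∇_{(x,u)}Ψ(σ,τ,x,u,y,v,ξ)⟩| + |∂Ψ/∂σ(σ,τ,x,u,y,v,ξ)| ≥ δ₁/2, where Ψ(σ,τ,x,u,y,v,ξ) = Φ(σ,τ,x,u,y,v) − ⟨x, ξ̄⟩ − u ξ_{2n+1} (so that ∂Ψ/∂σ = x_{2n} − y_{2n} − g(x̲−y̲)). -/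

import Mathlib

open MeasureTheory

/-- First `2n−1` coordinates of a vector in `ℝ^{2n}`. -/
def und {n : ℕ} (x : Fin (2 * n) → ℝ) : Fin (2 * n - 1) → ℝ :=
  fun i => x (Fin.castLE (by omega) i)

/-- Last coordinate of a vector in `ℝ^{2n}`. -/
def lastC {n : ℕ} (x : Fin (2 * n) → ℝ) : ℝ :=
  if h : 2 * n - 1 < 2 * n then x ⟨2 * n - 1, h⟩ else 0

/-- Pad a vector in `ℝ^{2n-1}` by a last coordinate to obtain a vector in `ℝ^{2n}`. -/
def pad {n : ℕ} (w : Fin (2 * n - 1) → ℝ) (t : ℝ) : Fin (2 * n) → ℝ :=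
  fun j => if h : (j : ℕ) < 2 * n - 1 then w ⟨j, h⟩ else t

/-- The bilinear form `xᵀJy`. -/
def bilJ {d : ℕ} (J : Matrix (Fin d) (Fin d) ℝ) (x y : Fin d → ℝ) : ℝ :=
  ∑ i, ∑ j, x i * J i j * y j

/-- Euclidean norm of a vector in `Fin d → ℝ`. -/
noncomputable def eucNorm {d : ℕ} (x : Fin d → ℝ) : ℝ :=
  Real.sqrt (∑ i, (x i) ^ 2)

/-- Nondegeneracy of the Hessian of `g` at `w`: `det D²g(w) ≠ 0`. -/
def HessNondeg {m : ℕ} (g : (Fin m → ℝ) → ℝ) (w : Fin m → ℝ) : Prop :=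
  (Matrix.of fun i j : Fin m =>
    iteratedFDeriv ℝ 2 g w ![Pi.single i 1, Pi.single j 1]).det ≠ 0

/-- The axis-parallel cube with corner `c` and side length `δ`. -/
def cube {m : ℕ} (c : Fin m → ℝ) (δ : ℝ) : Set (Fin m → ℝ) :=
  {y | ∀ i, c i ≤ y i ∧ y i ≤ c i + δ}

/-- `Γ(y̲) = (y̲, −g(−y̲)) ∈ ℝ^{2n}`. -/
noncomputable def Gam {n : ℕ} (g : (Fin (2 * n - 1) → ℝ) → ℝ)
    (w : Fin (2 * n - 1) → ℝ) : Fin (2 * n) → ℝ :=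
  pad w (-(g (-w)))

/-- `N(y̲) = e_{2n} − Σ_{i<2n} ∂_i g(−y̲) e_i`. -/
noncomputable def Nvec {n : ℕ} (g : (Fin (2 * n - 1) → ℝ) → ℝ)
    (w : Fin (2 * n - 1) → ℝ) : Fin (2 * n) → ℝ :=
  fun j => if h : (j : ℕ) < 2 * n - 1 then
    -(fderiv ℝ g (-w) (Pi.single (⟨j, h⟩ : Fin (2 * n - 1)) 1)) else 1

/-- The phase `Φ(σ,τ,x,u,y,v) = σ(x_{2n}−y_{2n}−g(x̲−y̲)) + τ(u−v+xᵀJy) + (τ/2)⟨Sx,x⟩`,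
as a function of `(x,u)`. -/
noncomputable def PhiFun {n : ℕ} (g : (Fin (2 * n - 1) → ℝ) → ℝ)
    (J S : Matrix (Fin (2 * n)) (Fin (2 * n)) ℝ)
    (σ τ : ℝ) (y : Fin (2 * n) → ℝ) (v : ℝ) :
    ((Fin (2 * n) → ℝ) × ℝ) → ℝ :=
  fun p => σ * (lastC p.1 - lastC y - g (und p.1 - und y))
    + τ * (p.2 - v + bilJ J p.1 y) + τ / 2 * bilJ S p.1 p.1

/-- `Ψ(σ,τ,x,u,y,v,ξ) = Φ(σ,τ,x,u,y,v) − ⟨x,ξ̄⟩ − u ξ_{2n+1}`, as a function of `(x,u)`. -/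
noncomputable def PsiFun {n : ℕ} (g : (Fin (2 * n - 1) → ℝ) → ℝ)
    (J S : Matrix (Fin (2 * n)) (Fin (2 * n)) ℝ)
    (σ τ : ℝ) (y : Fin (2 * n) → ℝ) (v : ℝ)
    (ξ : (Fin (2 * n) → ℝ) × ℝ) :
    ((Fin (2 * n) → ℝ) × ℝ) → ℝ :=
  fun p => PhiFun g J S σ τ y v p - (∑ i, p.1 i * ξ.1 i) - p.2 * ξ.2

theorem und_pad {n : ℕ} (w : Fin (2 * n - 1) → ℝ) (t : ℝ) : und (pad w t) = w := by
  ext i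
  simp [und, pad]

theorem lastC_pad {n : ℕ} (hn : 0 < n) (w : Fin (2 * n - 1) → ℝ) (t : ℝ) :
    lastC (pad w t) = t := by
  have h : 2 * n - 1 < 2 * n := by omega
  simp [lastC, pad, h]

theorem differentiable_PhiFun {n : ℕ} {g : (Fin (2 * n - 1) → ℝ) → ℝ}
    (hg : Differentiable ℝ g) (J S : Matrix (Fin (2 * n)) (Fin (2 * n)) ℝ)
    (σ τ : ℝ) (y : Fin (2 * n) → ℝ) (v : ℝ) :
    Differentiable ℝ (PhiFun g J S σ τ y v) := by
  have hund : Differentiable ℝ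
      (fun p : (Fin (2 * n) → ℝ) × ℝ => und p.1 - und y) := by
    unfold und
    fun_prop
  have hlast : Differentiable ℝ (fun p : (Fin (2 * n) → ℝ) × ℝ => lastC p.1) := by
    unfold lastC
    split_ifs <;> fun_prop
  have hgund : Differentiable ℝ
      (fun p : (Fin (2 * n) → ℝ) × ℝ => g (und p.1 - und y)) := hg.comp hund
  unfold PhiFun bilJ
  fun_prop

theorem fderiv_PsiFun_apply {n : ℕ} {g : (Fin (2 * n - 1) → ℝ) → ℝ}
    (hg : Differentiable ℝ g) (J S : Matrix (Fin (2 * n)) (Fin (2 * n)) ℝ)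
    (σ τ : ℝ) (y : Fin (2 * n) → ℝ) (v : ℝ) (ξ p w : (Fin (2 * n) → ℝ) × ℝ) :
    fderiv ℝ (PsiFun g J S σ τ y v ξ) p w
      = fderiv ℝ (PhiFun g J S σ τ y v) p w - ∑ i, w.1 i * ξ.1 i - w.2 * ξ.2 := by
  let L : ((Fin (2 * n) → ℝ) × ℝ) →L[ℝ] ℝ :=
    LinearMap.toContinuousLinearMap
      { toFun := fun p => ∑ i, p.1 i * ξ.1 i + p.2 * ξ.2
        map_add' := fun a b => by
          simp only [Prod.fst_add, Prod.snd_add, Pi.add_apply, add_mul, Finset.sum_add_distrib]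
          ring
        map_smul' := fun r a => by
          simp only [Prod.smul_fst, Prod.smul_snd, Pi.smul_apply, smul_eq_mul, mul_assoc,
            ← Finset.mul_sum, RingHom.id_apply, mul_add] }
  have hL : ∀ q, L q = ∑ i, q.1 i * ξ.1 i + q.2 * ξ.2 := fun _ => rfl
  have hPsi : PsiFun g J S σ τ y v ξ = fun q => PhiFun g J S σ τ y v q - L q := by
    ext q
    simp only [PsiFun, hL]
    ring
  rw [hPsi, fderiv_fun_sub (differentiable_PhiFun hg J S σ τ y v p) L.differentiableAt,
    L.fderiv, sub_apply, hL]
  ring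

theorem deriv_PsiFun {n : ℕ} (g : (Fin (2 * n - 1) → ℝ) → ℝ)
    (J S : Matrix (Fin (2 * n)) (Fin (2 * n)) ℝ)
    (σ τ : ℝ) (y : Fin (2 * n) → ℝ) (v : ℝ) (ξ p : (Fin (2 * n) → ℝ) × ℝ) :
    deriv (fun σ' => PsiFun g J S σ' τ y v ξ p) σ
      = lastC p.1 - lastC y - g (und p.1 - und y) := by
  simp [PsiFun, PhiFun]

/-- lower bound for the phase gradient off the plate (tangential case).
If `|ξ_i − ξ_{2n+1}⟨JΓ(y̲^ν),e_i⟩| ≥ C₁δ₁` with `C₁ ≥ 2A`, then on the admissible ranges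
`|⟨V_{ν,i}, ∇_{(x,u)}Ψ⟩| + |∂Ψ/∂σ| ≥ δ₁/2`. -/
theorem stmt12 (n : ℕ) (hn : 2 ≤ n)
    (J : Matrix (Fin (2 * n)) (Fin (2 * n)) ℝ)
    (hJskew : J.transpose = -J) (hJinv : IsUnit J.det)
    (g : (Fin (2 * n - 1) → ℝ) → ℝ) (hg : ContDiff ℝ (⊤ : ℕ∞) g)
    (hgrad0 : fderiv ℝ g 0 = 0)
    (hHess : ∀ w, eucNorm w ≤ 1 → HessNondeg g w)
    (S : Matrix (Fin (2 * n)) (Fin (2 * n)) ℝ)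
    (hSsym : S.transpose = S) (hSinv : IsUnit S.det)
    (hSe : S.mulVec ((J⁻¹).transpose.mulVec
        (Pi.single (⟨2 * n - 1, by omega⟩ : Fin (2 * n)) 1))
      = -(Pi.single (⟨2 * n - 1, by omega⟩ : Fin (2 * n)) 1))
    (k l : ℕ) (hl : 1 ≤ l) (hlk : 3 * l ≤ k)
    (δ₀ δ₁ : ℝ) (hδ₀ : (2 : ℝ) ^ (-(l : ℤ)) < δ₀) (hδ₀' : δ₀ ≤ 1) (hδ₁ : δ₁ < δ₀)
    (hδ₁' : Real.sqrt ((2 : ℝ) ^ (-(l : ℤ)) * δ₀) ≤ δ₁)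
    (c : Fin (2 * n - 1) → ℝ) (hc : cube c δ₁ ⊆ {y | ∀ i, |y i| ≤ δ₀})
    (yν : Fin (2 * n - 1) → ℝ) (hyν : yν ∈ cube c δ₁)
    (u₀ : ℝ) (hu₀ : |u₀| ≤ 1)
    (A : ℝ) (hA1 : 1 ≤ A)
    (hA : ∀ i : Fin (2 * n),
      ∀ yb ∈ cube c δ₁, ∀ y2n : ℝ, |y2n| ≤ 1 → ∀ v : ℝ,
      ∀ (x : Fin (2 * n) → ℝ) (u : ℝ),
        eucNorm x + |u - u₀| ≤ (2 : ℝ) ^ (-(l : ℤ)) →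
      ∀ σ : ℝ, (2 : ℝ) ^ (-(l : ℤ) - 2) ≤ |σ| → |σ| ≤ (2 : ℝ) ^ (-(l : ℤ) + 2) →
      ∀ τ : ℝ, 1 / 4 ≤ |τ| → |τ| ≤ 4 →
        |fderiv ℝ (PhiFun g J S σ τ (pad yb y2n) v) (x, u)
            (Pi.single i 1, -((J.mulVec (Gam g yν)) i))|
          ≤ A * (δ₁ + |lastC x - y2n - g (und x - yb)|))
    (C₁ : ℝ) (hC₁ : 2 * A ≤ C₁) :
    ∀ (ξ : (Fin (2 * n) → ℝ) × ℝ) (i : Fin (2 * n)),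
      C₁ * δ₁ ≤ |ξ.1 i - ξ.2 * (J.mulVec (Gam g yν)) i| →
      ∀ yb ∈ cube c δ₁, ∀ y2n : ℝ, |y2n| ≤ 1 → ∀ v : ℝ,
      ∀ (x : Fin (2 * n) → ℝ) (u : ℝ),
        eucNorm x + |u - u₀| ≤ (2 : ℝ) ^ (-(l : ℤ)) →
      ∀ σ : ℝ, (2 : ℝ) ^ (-(l : ℤ) - 2) ≤ |σ| → |σ| ≤ (2 : ℝ) ^ (-(l : ℤ) + 2) →
      ∀ τ : ℝ, 1 / 4 ≤ |τ| → |τ| ≤ 4 →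
        δ₁ / 2 ≤
          |fderiv ℝ (PsiFun g J S σ τ (pad yb y2n) v ξ) (x, u)
              (Pi.single i 1, -((J.mulVec (Gam g yν)) i))|
          + |deriv (fun σ' => PsiFun g J S σ' τ (pad yb y2n) v ξ (x, u)) σ| := by
  intro ξ i hξ yb hyb y2n hy2n v x u hxu σ hσ hσ' τ hτ hτ'
  have hbound := hA i yb hyb y2n hy2n v x u hxu σ hσ hσ' τ hτ hτ'
  have hδ : 0 ≤ δ₁ := (Real.sqrt_nonneg _).trans hδ₁'
  rw [fderiv_PsiFun_apply (hg.differentiable (by simp)), deriv_PsiFun, und_pad,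
    lastC_pad (by omega)]
  have hsum : ∑ j, (Pi.single i 1 : Fin (2 * n) → ℝ) j * ξ.1 j = ξ.1 i := by
    simp [Pi.single_apply]
  simp only [hsum]
  set D := fderiv ℝ (PhiFun g J S σ τ (pad yb y2n) v) (x, u)
    (Pi.single i 1, -((J.mulVec (Gam g yν)) i))
  set B := |lastC x - y2n - g (und x - yb)|
  set E := ξ.1 i - ξ.2 * (J.mulVec (Gam g yν)) i with hE
  have hgrad : D - ξ.1 i - -(J.mulVec (Gam g yν)) i * ξ.2 = D - E := by
    rw [hE]
    ring
  rw [hgrad]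
  have htri : |E| - |D| ≤ |D - E| := by
    rw [abs_sub_comm D E]
    exact abs_sub_abs_le_abs_sub E D
  rcases le_total (δ₁ / 2) B with hB | hB
  · linarith [abs_nonneg (D - E)]
  · have hCδ : 2 * A * δ₁ ≤ C₁ * δ₁ := mul_le_mul_of_nonneg_right hC₁ hδ
    have hAB : A * B ≤ A * (δ₁ / 2) := mul_le_mul_of_nonneg_left hB (by linarith)
    have hAδ : δ₁ ≤ A * δ₁ := le_mul_of_one_le_left hδ hA1
    have hB0 : 0 ≤ B := abs_nonneg _
    linarith
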